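/- arXiv:2201.04082 — 3 statements merged into one kernel-verified Lean document; each statement's English description precedes it below -/
import Mathlib

section
/- Let g, h₁, h₂ ∈ ℂ² be such that (a) the rank-one Hermitian matrices g g^H, h₁ h₁^H, h₂ h₂^H are linearly independent over ℝ in the real vector space of 2×2 Hermitian matrices, and (b) the identity matrix I₂ is not in their real linear span. Suppose λ₁, λ₂, λ₃, λ₄ ∈ ℝ with (λ₁, λ₂, λ₃, λ₄) ≠ 0, and suppose W ∈ ℂ^{2×2} is Hermitian positive semidefinite with W ≠ 0 such that Λ := λ₄ I₂ − λ₁ g g^H − λ₂ h₁ h₁^H − λ₃ h₂ h₂^H is positive semidefinite and Λ W = 0. Then rank(W) = 1. -/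
open Matrix
open scoped ComplexOrder

/-- A nonzero matrix over a field has positive rank. -/
theorem Matrix.rank_pos_of_ne_zero {K m n : Type*} [Field K] [Finite m] [Fintype n]
    {A : Matrix m n K} (hA : A ≠ 0) : 0 < A.rank := by
  classical
  refine Nat.pos_of_ne_zero fun h => hA ?_
  rwa [Matrix.rank, Submodule.finrank_eq_zero, LinearMap.range_eq_bot, ← Matrix.toLin'_apply',
    LinearEquiv.map_eq_zero_iff] at h

/-- **Proposition 1 via its KKT argument.** Let `g, h₁, h₂ ∈ ℂ²` be such that
(a) `g gᴴ, h₁ h₁ᴴ, h₂ h₂ᴴ` are linearly independent over `ℝ` (in the Hermitian matrices), and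
(b) `I₂` is not in their real linear span. If `(λ₁, λ₂, λ₃, λ₄) ≠ 0`, `W ⪰ 0`, `W ≠ 0`,
`Λ := λ₄ I₂ − λ₁ g gᴴ − λ₂ h₁ h₁ᴴ − λ₃ h₂ h₂ᴴ ⪰ 0`, and `Λ W = 0`, then `rank W = 1`. -/
theorem stmt_9 (g h1 h2 : Fin 2 → ℂ)
    (ha : LinearIndependent ℝ
      ![vecMulVec g (star g), vecMulVec h1 (star h1), vecMulVec h2 (star h2)])
    (hb : (1 : Matrix (Fin 2) (Fin 2) ℂ) ∉ Submodule.span ℝ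
      ({vecMulVec g (star g), vecMulVec h1 (star h1), vecMulVec h2 (star h2)} :
        Set (Matrix (Fin 2) (Fin 2) ℂ)))
    (l1 l2 l3 l4 : ℝ) (hl : (l1, l2, l3, l4) ≠ (0, 0, 0, 0))
    (W : Matrix (Fin 2) (Fin 2) ℂ) (hW : W.PosSemidef) (hW0 : W ≠ 0)
    (Λ : Matrix (Fin 2) (Fin 2) ℂ)
    (hΛdef : Λ = l4 • (1 : Matrix (Fin 2) (Fin 2) ℂ) - l1 • vecMulVec g (star g)
        - l2 • vecMulVec h1 (star h1) - l3 • vecMulVec h2 (star h2))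
    (hΛ : Λ.PosSemidef) (hΛW : Λ * W = 0) : W.rank = 1 := by
  have hΛ0 : Λ ≠ 0 := by
    intro h
    have hli : LinearIndependent ℝ ![(1 : Matrix (Fin 2) (Fin 2) ℂ),
        vecMulVec g (star g), vecMulVec h1 (star h1), vecMulVec h2 (star h2)] := by
      refine linearIndependent_finCons.mpr ⟨ha, ?_⟩
      simpa only [Matrix.range_cons, Matrix.range_empty, Set.singleton_union,
        Set.union_empty] using hb
    have hcoeff := Fintype.linearIndependent_iff.mp hli ![l4, -l1, -l2, -l3] (by
      rw [← h, hΛdef, Fin.sum_univ_four]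
      change l4 • (1 : Matrix (Fin 2) (Fin 2) ℂ) + (-l1) • vecMulVec g (star g)
        + (-l2) • vecMulVec h1 (star h1) + (-l3) • vecMulVec h2 (star h2) = _
      module)
    have e4 := hcoeff 0
    have e1 := hcoeff 1
    have e2 := hcoeff 2
    have e3 := hcoeff 3
    simp only [Matrix.cons_val, neg_eq_zero] at e1 e2 e3 e4
    exact hl (by rw [e1, e2, e3, e4])
  have hle := Matrix.rank_add_rank_le_card_of_mul_eq_zero hΛW
  rw [Fintype.card_fin] at hle
  have hΛpos := Matrix.rank_pos_of_ne_zero hΛ0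
  have hWpos := Matrix.rank_pos_of_ne_zero hW0
  omega
end

section
/- The set of triples (g, h₁, h₂) ∈ (ℂ²)³ for which there exist real numbers λ₁, λ₂, λ₃ satisfying λ₁ g g^H + λ₂ h₁ h₁^H + λ₃ h₂ h₂^H = I₂ has Lebesgue measure zero (identifying (ℂ²)³ with ℝ¹² in the natural way). -/
open Matrix MeasureTheory

/-- The zero set of a real-analytic function on a finite-dimensional space that does not vanish
identically is a null set for every additive Haar measure. -/
theorem AnalyticOnNhd.addHaar_zeros_eq_zero {E : Type*} [NormedAddCommGroup E] [NormedSpace ℝ E]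
    [FiniteDimensional ℝ E] [MeasurableSpace E] [BorelSpace E] (μ : Measure E)
    [μ.IsAddHaarMeasure] {f : E → ℝ} (hf : AnalyticOnNhd ℝ f Set.univ) {x₀ : E}
    (hx₀ : f x₀ ≠ 0) : μ {x | f x = 0} = 0 := by
  have : SecondCountableTopology E :=
    have := FiniteDimensional.proper_real E
    inferInstance
  -- The zeros of `f` on each line through `x₀` form a null set; then use the scaling of `μ`.
  have hcont : Continuous f := continuousOn_univ.mp hf.continuousOn
  have hmeas : MeasurableSet {p : ℝ × E | f (x₀ + p.1 • p.2) ≠ 0} :=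
    (isOpen_ne_fun (by fun_prop) continuous_const).measurableSet
  have hline (x : E) : ∀ᵐ t : ℝ, f (x₀ + t • x) ≠ 0 := by
    have han : AnalyticOnNhd ℝ (fun t : ℝ ↦ f (x₀ + t • x)) Set.univ := fun t _ ↦
      (hf (x₀ + t • x) (Set.mem_univ _)).comp (f := fun t : ℝ ↦ x₀ + t • x) (by fun_prop)
    have hmem := han.preimage_zero_mem_codiscrete (x := 0) (by simpa using hx₀)
    have hae := ae_restrict_le_codiscreteWithin (μ := volume) MeasurableSet.univ hmem
    rwa [Measure.restrict_univ] at hae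
  have hae : ∀ᵐ t : ℝ, ∀ᵐ x ∂μ, f (x₀ + t • x) ≠ 0 :=
    (Measure.ae_ae_comm hmeas).mpr (Filter.Eventually.of_forall hline)
  obtain ⟨t, ht, ht₀⟩ := (hae.and (Measure.ae_ne volume 0)).exists
  have hnull : μ ((t • ·) ⁻¹' ((x₀ + ·) ⁻¹' {x | f x = 0})) = 0 := by
    simpa [ae_iff] using ht
  rw [Measure.addHaar_preimage_smul μ ht₀, measure_preimage_add] at hnull
  simpa [ht₀] using hnull

/-- The coordinates of the traceless part of the rank-one Hermitian matrix `v vᴴ`. -/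
noncomputable def blochVector (v : Fin 2 → ℂ) : Fin 3 → ℝ :=
  ![(v 0).re ^ 2 + (v 0).im ^ 2 - (v 1).re ^ 2 - (v 1).im ^ 2,
    (v 0).re * (v 1).re + (v 0).im * (v 1).im,
    (v 0).im * (v 1).re - (v 0).re * (v 1).im]

/-- If real multiples of three rank-one Hermitian matrices sum to the identity, then their Bloch
vectors are linearly dependent. -/
theorem det_blochVector_eq_zero {u v w : Fin 2 → ℂ} {a b c : ℝ}
    (h : a • vecMulVec u (star u) + b • vecMulVec v (star v) + c • vecMulVec w (star w) =
      (1 : Matrix (Fin 2) (Fin 2) ℂ)) :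
    (Matrix.of ![blochVector u, blochVector v, blochVector w]).det = 0 := by
  have h00 := congrArg Complex.re (congrFun (congrFun h 0) 0)
  have h11 := congrArg Complex.re (congrFun (congrFun h 1) 1)
  have h01 := congrFun (congrFun h 0) 1
  have h01r := congrArg Complex.re h01
  have h01i := congrArg Complex.im h01
  simp [vecMulVec_apply] at h00 h11 h01r h01i
  refine Matrix.exists_vecMul_eq_zero_iff.mp ⟨![a, b, c], fun h0 ↦ ?_, ?_⟩
  · have ha : a = 0 := congrFun h0 0
    have hb : b = 0 := congrFun h0 1
    have hc : c = 0 := congrFun h0 2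
    simp [ha, hb, hc] at h00
  · ext i
    fin_cases i <;> simp [vecMul, dotProduct, Fin.sum_univ_three, blochVector]
    · linear_combination h00 - h11
    · linear_combination h01r
    · linear_combination h01i

theorem analyticOnNhd_det_blochVector :
    AnalyticOnNhd ℝ (fun t : (Fin 2 → ℂ) × (Fin 2 → ℂ) × (Fin 2 → ℂ) ↦
      (Matrix.of ![blochVector t.1, blochVector t.2.1, blochVector t.2.2]).det) Set.univ := by
  intro t _
  have hre {g : (Fin 2 → ℂ) × (Fin 2 → ℂ) × (Fin 2 → ℂ) → ℂ} (hg : AnalyticAt ℝ g t) :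
      AnalyticAt ℝ (fun s ↦ (g s).re) t := (Complex.reCLM.analyticAt _).comp hg
  have him {g : (Fin 2 → ℂ) × (Fin 2 → ℂ) × (Fin 2 → ℂ) → ℂ} (hg : AnalyticAt ℝ g t) :
      AnalyticAt ℝ (fun s ↦ (g s).im) t := (Complex.imCLM.analyticAt _).comp hg
  have h₁ (i : Fin 2) : AnalyticAt ℝ
      (fun s : (Fin 2 → ℂ) × (Fin 2 → ℂ) × (Fin 2 → ℂ) ↦ s.1 i) t :=
    ((ContinuousLinearMap.proj (R := ℝ) (φ := fun _ : Fin 2 ↦ ℂ) i).comp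
      (ContinuousLinearMap.fst ℝ _ _)).analyticAt t
  have h₂ (i : Fin 2) : AnalyticAt ℝ
      (fun s : (Fin 2 → ℂ) × (Fin 2 → ℂ) × (Fin 2 → ℂ) ↦ s.2.1 i) t :=
    ((ContinuousLinearMap.proj (R := ℝ) (φ := fun _ : Fin 2 ↦ ℂ) i).comp
      ((ContinuousLinearMap.fst ℝ _ _).comp (ContinuousLinearMap.snd ℝ _ _))).analyticAt t
  have h₃ (i : Fin 2) : AnalyticAt ℝ
      (fun s : (Fin 2 → ℂ) × (Fin 2 → ℂ) × (Fin 2 → ℂ) ↦ s.2.2 i) t :=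
    ((ContinuousLinearMap.proj (R := ℝ) (φ := fun _ : Fin 2 ↦ ℂ) i).comp
      ((ContinuousLinearMap.snd ℝ _ _).comp (ContinuousLinearMap.snd ℝ _ _))).analyticAt t
  have h₁r i := hre (h₁ i)
  have h₁i i := him (h₁ i)
  have h₂r i := hre (h₂ i)
  have h₂i i := him (h₂ i)
  have h₃r i := hre (h₃ i)
  have h₃i i := him (h₃ i)
  simp only [det_fin_three, blochVector, of_apply, cons_val]
  fun_prop

/-- The set of triples `(g, h₁, h₂) ∈ (ℂ²)³` for which there exist real
`λ₁, λ₂, λ₃` with `λ₁ g gᴴ + λ₂ h₁ h₁ᴴ + λ₃ h₂ h₂ᴴ = I₂` has Lebesgue measure zero. -/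
theorem stmt_10 :
    volume {t : (Fin 2 → ℂ) × (Fin 2 → ℂ) × (Fin 2 → ℂ) |
      ∃ l1 l2 l3 : ℝ,
        l1 • vecMulVec t.1 (star t.1) + l2 • vecMulVec t.2.1 (star t.2.1) +
          l3 • vecMulVec t.2.2 (star t.2.2) = (1 : Matrix (Fin 2) (Fin 2) ℂ)} = 0 := by
  have : BorelSpace ((Fin 2 → ℂ) × (Fin 2 → ℂ) × (Fin 2 → ℂ)) := Prod.borelSpace
  have : (volume : Measure ((Fin 2 → ℂ) × (Fin 2 → ℂ) × (Fin 2 → ℂ))).IsAddHaarMeasure := by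
    have : (volume : Measure ((Fin 2 → ℂ) × (Fin 2 → ℂ))).IsAddHaarMeasure :=
      Measure.prod.instIsAddHaarMeasure _ _
    exact Measure.prod.instIsAddHaarMeasure _ _
  refine measure_mono_null ?_ (analyticOnNhd_det_blochVector.addHaar_zeros_eq_zero volume
    (x₀ := (![1, 0], ![1, 1], ![1, Complex.I])) ?_)
  · rintro t ⟨l1, l2, l3, h⟩
    exact det_blochVector_eq_zero h
  · simp [det_fin_three, blochVector]
end

section
/- Let M ∈ ℂ^{N×N} be Hermitian whose largest eigenvalue μ₁ is simple (i.e., μ₁ > μ₂, where μ₁ ≥ μ₂ ≥ … ≥ μ_N are the eigenvalues of M), let μ ∈ ℝ, and set Λ = μ I_N − M. Suppose Λ is positive semidefinite, W ∈ ℂ^{N×N} is Hermitian positive semidefinite with W ≠ 0, and Λ W = 0. Then μ = μ₁, the null space of Λ is one-dimensional, and rank(W) = 1. -/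
open Matrix
open scoped ComplexOrder

namespace Matrix.IsHermitian

variable {n : Type*} [Fintype n] [DecidableEq n] {A : Matrix n n ℂ}

/-- An eigenvalue of a Hermitian matrix `A` is at most `μ` when `μ I - A` is positive
semidefinite. -/
lemma eigenvalues_le_of_posSemidef_smul_one_sub (hA : A.IsHermitian) {μ : ℝ}
    (h : (μ • (1 : Matrix n n ℂ) - A).PosSemidef) (i : n) : hA.eigenvalues i ≤ μ := by
  have h1 := h.re_dotProduct_nonneg (hA.eigenvectorBasis i).ofLp
  have h2 : star (hA.eigenvectorBasis i).ofLp ⬝ᵥ (hA.eigenvectorBasis i).ofLp = 1 := by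
    have := hA.eigenvectorBasis.inner_eq_one i
    rwa [EuclideanSpace.inner_eq_star_dotProduct, dotProduct_comm] at this
  rw [sub_mulVec, smul_mulVec, one_mulVec, hA.mulVec_eigenvectorBasis, ← sub_smul,
    dotProduct_smul, h2] at h1
  simpa using h1

/-- An eigenvector of a Hermitian matrix for `μ` is orthogonal to the members of the eigenvector
basis whose eigenvalue differs from `μ`. -/
lemma inner_eigenvectorBasis_eq_zero (hA : A.IsHermitian) {μ : ℝ} {x : n → ℂ}
    (hx : A *ᵥ x = μ • x) {i : n} (hi : hA.eigenvalues i ≠ μ) :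
    inner ℂ (hA.eigenvectorBasis i) (WithLp.toLp 2 x) = 0 := by
  rw [EuclideanSpace.inner_eq_star_dotProduct, dotProduct_comm]
  set b := (hA.eigenvectorBasis i).ofLp with hb
  change star b ⬝ᵥ x = 0
  have h1 : star b ⬝ᵥ (A *ᵥ x) = hA.eigenvalues i • (star b ⬝ᵥ x) := by
    have h2 : star b ᵥ* A = star (A *ᵥ b) := by rw [star_mulVec, hA.eq]
    rw [dotProduct_mulVec, h2, hA.mulVec_eigenvectorBasis, star_smul, smul_dotProduct]
    simp [hb]
  rw [hx, dotProduct_smul, ← sub_eq_zero, ← sub_smul] at h1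
  exact (smul_eq_zero.mp h1).resolve_left (sub_ne_zero.mpr hi.symm)

/-- A nonzero vector with `A x = μ x` forces `μ` to occur among the eigenvalues. -/
lemma exists_eigenvalues_eq_of_mulVec_eq_smul (hA : A.IsHermitian) {μ : ℝ} {x : n → ℂ}
    (hx : A *ᵥ x = μ • x) (hx0 : x ≠ 0) : ∃ i, hA.eigenvalues i = μ := by
  by_contra! h
  have h1 := hA.eigenvectorBasis.sum_repr' (WithLp.toLp 2 x)
  simp only [fun i => hA.inner_eigenvectorBasis_eq_zero hx (h i), zero_smul,
    Finset.sum_const_zero] at h1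
  exact hx0 (congrArg WithLp.ofLp h1).symm

/-- If `i` is the only index with eigenvalue `μ`, then every solution of `A x = μ x` is a multiple
of the corresponding basis eigenvector. -/
lemma mem_span_eigenvectorBasis_of_mulVec_eq_smul (hA : A.IsHermitian) {μ : ℝ} {i : n}
    (hi : ∀ j, j ≠ i → hA.eigenvalues j ≠ μ) {x : n → ℂ} (hx : A *ᵥ x = μ • x) :
    x ∈ Submodule.span ℂ {(hA.eigenvectorBasis i).ofLp} := by
  have h1 := hA.eigenvectorBasis.sum_repr' (WithLp.toLp 2 x)
  rw [Finset.sum_eq_single i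
    (fun j _ hj => by rw [hA.inner_eigenvectorBasis_eq_zero hx (hi j hj), zero_smul])
    (fun h => absurd (Finset.mem_univ i) h)] at h1
  exact Submodule.mem_span_singleton.mpr ⟨_, congrArg WithLp.ofLp h1⟩

end Matrix.IsHermitian

/-- General-case rank argument: let `M ∈ ℂ^{N×N}` be Hermitian whose largest
eigenvalue (the one at index `i0`) is simple, `μ ∈ ℝ`, and `Λ = μ I − M`. If `Λ ⪰ 0`, `W ⪰ 0`,
`W ≠ 0`, and `Λ W = 0`, then `μ` equals the largest eigenvalue of `M`, the null space of `Λ`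
is one-dimensional, and `rank W = 1`. -/
theorem stmt_14 {N : ℕ} (M : Matrix (Fin N) (Fin N) ℂ) (hM : M.IsHermitian)
    (i0 : Fin N) (hsimple : ∀ j, j ≠ i0 → hM.eigenvalues j < hM.eigenvalues i0)
    (μ : ℝ) (Λ : Matrix (Fin N) (Fin N) ℂ)
    (hΛdef : Λ = μ • (1 : Matrix (Fin N) (Fin N) ℂ) - M)
    (hΛ : Λ.PosSemidef)
    (W : Matrix (Fin N) (Fin N) ℂ) (hW : W.PosSemidef) (hW0 : W ≠ 0)
    (hΛW : Λ * W = 0) :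
    μ = hM.eigenvalues i0 ∧
      Module.finrank ℂ (LinearMap.ker Λ.mulVecLin) = 1 ∧
      W.rank = 1 := by
  subst hΛdef
  have hker {x : Fin N → ℂ}
      (hx : x ∈ LinearMap.ker (μ • (1 : Matrix (Fin N) (Fin N) ℂ) - M).mulVecLin) :
      M *ᵥ x = μ • x := by
    rw [LinearMap.mem_ker, mulVecLin_apply, sub_mulVec, smul_mulVec, one_mulVec,
      sub_eq_zero] at hx
    exact hx.symm
  have hrange : LinearMap.range W.mulVecLin ≤
      LinearMap.ker (μ • (1 : Matrix (Fin N) (Fin N) ℂ) - M).mulVecLin := by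
    rintro _ ⟨x, rfl⟩
    rw [LinearMap.mem_ker, mulVecLin_apply, mulVecLin_apply, mulVec_mulVec, hΛW, zero_mulVec]
  have hbot : LinearMap.range W.mulVecLin ≠ ⊥ := by
    rw [Ne, LinearMap.range_eq_bot]
    exact fun h => hW0 (Matrix.toLin'.map_eq_zero_iff.mp h)
  have hrank : 1 ≤ W.rank := Submodule.one_le_finrank_iff.mpr hbot
  obtain ⟨y, hy, hy0⟩ := Submodule.exists_mem_ne_zero_of_ne_bot hbot
  obtain ⟨i, hi⟩ := hM.exists_eigenvalues_eq_of_mulVec_eq_smul (hker (hrange hy)) hy0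
  have hle := hM.eigenvalues_le_of_posSemidef_smul_one_sub hΛ i0
  obtain rfl : i = i0 := by
    by_contra hne
    linarith [hsimple i hne]
  have hspan : LinearMap.ker (μ • (1 : Matrix (Fin N) (Fin N) ℂ) - M).mulVecLin ≤
      Submodule.span ℂ {(hM.eigenvectorBasis i).ofLp} := fun x hx =>
    hM.mem_span_eigenvectorBasis_of_mulVec_eq_smul
      (fun j hj => (hi ▸ hsimple j hj).ne) (hker hx)
  have hker_le := (Submodule.finrank_mono hspan).trans (finrank_span_le_card _)
  rw [Set.toFinset_singleton, Finset.card_singleton] at hker_le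
  have hrank_le : W.rank ≤ _ := Submodule.finrank_mono hrange
  exact ⟨hi.symm, by omega, by omega⟩
end
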